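/- (Accuracy of empirical influences.) Let X^{(1)}, …, X^{(n)} be independent samples from the Ising model P, let P̂ denote the empirical distribution P̂(X_W = x_W) := (1/n)·Σ_{t=1}^n 1{X^{(t)}_W = x_W}, and let ν̄̂(u,i,S) denote the average conditional influence computed from P̂. Suppose ℓ ≤ p/4 − 2 and n ≥ (144(ℓ+3)/(ε²·δ^{2ℓ}))·log(p/ζ). Then with probability at least 1 − ζ, for all distinct u,i ∈ V and all S ⊆ V∖{u,i} with |S| ≤ ℓ, one has |ν̄(u,i,S) − ν̄̂(u,i,S)| ≤ ε. -/

import Mathlib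

noncomputable section

open Real Finset

/-- The spin value (±1) associated to a Boolean. -/
def spin (b : Bool) : ℝ := if b then 1 else -1

/-- The energy (Hamiltonian, without normalization) of a configuration of the Ising model:
`Σ_{{i,j}∈E} θ_{ij} x_i x_j + Σ_{i∈V} θ_i x_i`, where the sum over edges is written as half the
sum over ordered adjacent pairs (the edge couplings are symmetric). -/
def energy {p : ℕ} (G : SimpleGraph (Fin p)) [DecidableRel G.Adj]
    (θe : Fin p → Fin p → ℝ) (θv : Fin p → ℝ) (x : Fin p → Bool) : ℝ :=
  (∑ i, ∑ j, if G.Adj i j then θe i j * spin (x i) * spin (x j) else 0) / 2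
    + ∑ i, θv i * spin (x i)

/-- The Ising model probability mass function
`P(x) = exp(Σ_{{i,j}∈E} θ_{ij} x_i x_j + Σ_{i∈V} θ_i x_i − Φ(θ))`. -/
def isingPMF {p : ℕ} (G : SimpleGraph (Fin p)) [DecidableRel G.Adj]
    (θe : Fin p → Fin p → ℝ) (θv : Fin p → ℝ) (x : Fin p → Bool) : ℝ :=
  Real.exp (energy G θe θv x) / ∑ y : Fin p → Bool, Real.exp (energy G θe θv y)

open Classical in
/-- Probability of an event under a pmf on configurations. -/
def prob {p : ℕ} (μ : (Fin p → Bool) → ℝ) (A : (Fin p → Bool) → Prop) : ℝ :=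
  ∑ x : Fin p → Bool, if A x then μ x else 0

/-- Conditional probability `P(A | B)`. -/
def condProb {p : ℕ} (μ : (Fin p → Bool) → ℝ) (A B : (Fin p → Bool) → Prop) : ℝ :=
  prob μ (fun x => A x ∧ B x) / prob μ B

open Classical in
/-- Conditional expectation `E[f(X) | B]`. -/
def condExp {p : ℕ} (μ : (Fin p → Bool) → ℝ) (B : (Fin p → Bool) → Prop)
    (f : (Fin p → Bool) → ℝ) : ℝ :=
  (∑ x : Fin p → Bool, if B x then μ x * f x else 0) / prob μ B

/-- The event `X_S = σ_S` (agreement with `σ` on the set `S`). -/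
def agree {p : ℕ} (S : Finset (Fin p)) (σ : Fin p → Bool) (x : Fin p → Bool) : Prop :=
  ∀ i ∈ S, x i = σ i

/-- The conditional influence
`ν_{u|i;x_S} = P(X_u=+1 | X_i=+1, X_S=x_S) − P(X_u=+1 | X_i=−1, X_S=x_S)`. -/
def condInf {p : ℕ} (μ : (Fin p → Bool) → ℝ) (u i : Fin p) (S : Finset (Fin p))
    (σ : Fin p → Bool) : ℝ :=
  condProb μ (fun x => x u = true) (fun x => x i = true ∧ agree S σ x)
    - condProb μ (fun x => x u = true) (fun x => x i = false ∧ agree S σ x)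

/-- The weight `λ_i(x_S) = 2·P(X_i=+1|X_S=x_S)·P(X_i=−1|X_S=x_S)`. -/
def lamWeight {p : ℕ} (μ : (Fin p → Bool) → ℝ) (i : Fin p) (S : Finset (Fin p))
    (σ : Fin p → Bool) : ℝ :=
  2 * condProb μ (fun x => x i = true) (agree S σ)
    * condProb μ (fun x => x i = false) (agree S σ)

/-- The average conditional influence `ν̄(u,i,S) = E[λ_i(X_S)·|ν_{u|i;X_S}|]`, the expectation
over `X_S` with law the marginal of `μ` on `S` (the integrand depends on the configuration only
through its restriction to `S`). -/
def avgInf {p : ℕ} (μ : (Fin p → Bool) → ℝ) (u i : Fin p) (S : Finset (Fin p)) : ℝ :=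
  ∑ x : Fin p → Bool, μ x * (lamWeight μ i S x * |condInf μ u i S x|)

/-- `δ = (1/2)·e^{−2(βd+h)}`. -/
def deltaLB (β h : ℝ) (d : ℕ) : ℝ := (1/2) * Real.exp (-(2 * (β * d + h)))

/-- `τ* = α²·δ^{4d+1}/(16dβ)`. -/
def tauStar (α β h : ℝ) (d : ℕ) : ℝ :=
  α ^ 2 * (deltaLB β h d) ^ (4 * d + 1) / (16 * d * β)

/-- The conditional mutual information `I(X_u ; X_i | X_S)`, computed with natural logarithms,
written as the expectation of the log-likelihood ratio
`log( P(X_u,X_i,X_S)·P(X_S) / (P(X_u,X_S)·P(X_i,X_S)) )`. -/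
def condMI {p : ℕ} (μ : (Fin p → Bool) → ℝ) (u i : Fin p) (S : Finset (Fin p)) : ℝ :=
  ∑ x : Fin p → Bool, μ x * Real.log
    ((prob μ (fun z => z u = x u ∧ z i = x i ∧ agree S x z) * prob μ (agree S x))
      / (prob μ (fun z => z u = x u ∧ agree S x z)
          * prob μ (fun z => z i = x i ∧ agree S x z)))

/-- Hoeffding's lemma on a finite probability space. -/
theorem sum_exp_centered_le {Ω : Type*} [Fintype Ω] (w f : Ω → ℝ) (hw : ∀ x, 0 ≤ w x)
    (hw1 : ∑ x, w x = 1) (a : ℝ) (hf : ∀ x, f x ∈ Set.Icc a (a + 1)) (s : ℝ) :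
    ∑ x, w x * Real.exp (s * (f x - ∑ y, w y * f y)) ≤ Real.exp (s ^ 2 / 8) := by
  let _ : MeasurableSpace Ω := ⊤
  let P : PMF Ω := PMF.ofFintype (fun x => ENNReal.ofReal (w x)) (by
    rw [← ENNReal.ofReal_sum_of_nonneg fun x _ => hw x, hw1, ENNReal.ofReal_one])
  have hint (g : Ω → ℝ) : ∫ x, g x ∂P.toMeasure = ∑ x, w x * g x := by
    rw [PMF.integral_eq_sum]
    exact Finset.sum_congr rfl fun x _ => by
      rw [PMF.ofFintype_apply, ENNReal.toReal_ofReal (hw x), smul_eq_mul]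
  have hsub := ProbabilityTheory.hasSubgaussianMGF_of_mem_Icc (μ := P.toMeasure) (X := f)
    Measurable.of_discrete.aemeasurable (Filter.Eventually.of_forall hf)
  have hmgf := hsub.mgf_le s
  rw [ProbabilityTheory.mgf, hint, hint] at hmgf
  refine hmgf.trans_eq ?_
  congr 1
  simp
  ring

open Classical in
/-- One-sided Hoeffding inequality for independent samples from a finite probability space. -/
theorem hoeffding_upper_tail {Ω : Type*} [Fintype Ω] (w f : Ω → ℝ) (hw : ∀ x, 0 ≤ w x)
    (hw1 : ∑ x, w x = 1) (a : ℝ) (hf : ∀ x, f x ∈ Set.Icc a (a + 1)) (n : ℕ) (γ : ℝ)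
    (hγ : 0 ≤ γ) :
    ∑ xs : Fin n → Ω, (if n * γ ≤ ∑ t, (f (xs t) - ∑ y, w y * f y) then ∏ t, w (xs t) else 0)
      ≤ Real.exp (-(2 * n * γ ^ 2)) := by
  set m := ∑ y, w y * f y
  calc _ ≤ ∑ xs : Fin n → Ω, Real.exp (-(4 * n * γ ^ 2)) *
        ∏ t, (w (xs t) * Real.exp (4 * γ * (f (xs t) - m))) := by
        refine Finset.sum_le_sum fun xs _ => ?_
        have hprod : 0 ≤ ∏ t, w (xs t) := Finset.prod_nonneg fun t _ => hw _
        rw [Finset.prod_mul_distrib, ← Real.exp_sum, ← Finset.mul_sum, mul_left_comm,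
          ← Real.exp_add]
        split_ifs with hle
        · exact le_mul_of_one_le_right hprod (Real.one_le_exp (by nlinarith))
        · positivity
    _ = Real.exp (-(4 * n * γ ^ 2)) * (∑ x, w x * Real.exp (4 * γ * (f x - m))) ^ n := by
        rw [← Finset.mul_sum, Fintype.sum_pow]
    _ ≤ Real.exp (-(4 * n * γ ^ 2)) * Real.exp ((4 * γ) ^ 2 / 8) ^ n := by
        gcongr
        · exact Finset.sum_nonneg fun x _ => mul_nonneg (hw x) (Real.exp_nonneg _)
        · exact sum_exp_centered_le w f hw hw1 a hf (4 * γ)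
    _ = _ := by
        rw [← Real.exp_nat_mul, ← Real.exp_add]
        congr 1
        ring

/-- The empirical distribution of a sample. -/
def empirical {p n : ℕ} (xs : Fin n → Fin p → Bool) (x : Fin p → Bool) : ℝ :=
  ((Finset.univ.filter (fun t => xs t = x)).card : ℝ) / n

theorem empirical_nonneg {p n : ℕ} (xs : Fin n → Fin p → Bool) (x : Fin p → Bool) :
    0 ≤ empirical xs x := by
  unfold empirical
  positivity

open Classical in
theorem prob_empirical {p n : ℕ} (xs : Fin n → Fin p → Bool) (A : (Fin p → Bool) → Prop) :
    prob (empirical xs) A = (∑ t, if A (xs t) then (1 : ℝ) else 0) / n := by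
  have hcell (x : Fin p → Bool) : (if A x then empirical xs x else 0)
      = (∑ t, if xs t = x then (if A (xs t) then (1 : ℝ) else 0) else 0) / n := by
    unfold empirical
    split_ifs with hA
    · rw [Finset.natCast_card_filter]
      congr 1
      refine Finset.sum_congr rfl fun t _ => ?_
      by_cases hx : xs t = x <;> simp [hx, hA]
    · rw [Finset.sum_eq_zero, zero_div]
      intro t _
      by_cases hx : xs t = x <;> simp [hx, hA]
  simp only [prob, hcell]
  rw [← Finset.sum_div, Finset.sum_comm]
  simp

open Classical in
/-- Two-sided Hoeffding inequality for the empirical probability of an event. -/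
theorem prob_empirical_deviation_le {p : ℕ} (w : (Fin p → Bool) → ℝ) (hw : ∀ x, 0 ≤ w x)
    (hw1 : ∑ x, w x = 1) (A : (Fin p → Bool) → Prop) (n : ℕ) (hn : 0 < n) (γ : ℝ) (hγ : 0 ≤ γ) :
    ∑ xs : Fin n → (Fin p → Bool),
      (if γ < |prob w A - prob (empirical xs) A| then ∏ t, w (xs t) else 0)
      ≤ 2 * Real.exp (-(2 * n * γ ^ 2)) := by
  have hn' : (0 : ℝ) < n := by exact_mod_cast hn
  let f : (Fin p → Bool) → ℝ := fun x => if A x then 1 else 0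
  have hupper := hoeffding_upper_tail w f hw hw1 0
    (fun x => by dsimp only [f]; split_ifs <;> simp) n γ hγ
  have hlower := hoeffding_upper_tail w (fun x => -f x) hw hw1 (-1)
    (fun x => by dsimp only [f]; split_ifs <;> simp) n γ hγ
  have hmean : ∑ y, w y * f y = prob w A := by simp [f, prob]
  simp only [mul_neg, Finset.sum_neg_distrib, hmean] at hupper hlower
  rw [two_mul]
  refine le_trans ?_ (add_le_add hupper hlower)
  rw [← Finset.sum_add_distrib]
  refine Finset.sum_le_sum fun xs _ => ?_
  have hprod : 0 ≤ ∏ t, w (xs t) := Finset.prod_nonneg fun t _ => hw _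
  have hemp : ∑ t, f (xs t) = n * prob (empirical xs) A := by
    rw [prob_empirical]
    field_simp
    rfl
  simp only [Finset.sum_sub_distrib, Finset.sum_neg_distrib, hemp, Finset.sum_const,
    Finset.card_univ, Fintype.card_fin, nsmul_eq_mul]
  by_cases hdev : γ < |prob w A - prob (empirical xs) A|
  · rw [if_pos hdev]
    rcases lt_abs.mp hdev with hd | hd
    · rw [if_pos (c := _ ≤ -(_ : ℝ) - _) (by nlinarith)]
      split_ifs <;> linarith
    · rw [if_pos (c := _ ≤ (_ * _ : ℝ) - _) (by nlinarith)]
      split_ifs <;> linarith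
  · rw [if_neg hdev]
    split_ifs <;> linarith

/-- Lipschitz dependence of the normalized determinant on one diagonal entry. -/
theorem abs_normalized_det_sub_le {a a' b c d : ℝ} (ha : 0 ≤ a) (ha' : 0 ≤ a') (hb : 0 ≤ b)
    (hc : 0 ≤ c) (hd : 0 ≤ d) :
    |(a * d - b * c) / (a + b + c + d) - (a' * d - b * c) / (a' + b + c + d)| ≤ |a - a'| := by
  rcases eq_or_lt_of_le (show 0 ≤ b + c + d by positivity) with hr | hr
  · obtain rfl : b = 0 := by linarith
    obtain rfl : d = 0 := by linarith
    simp
  · have hs : 0 < a + b + c + d := by linarith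
    have hs' : 0 < a' + b + c + d := by linarith
    have heq : (a * d - b * c) / (a + b + c + d) - (a' * d - b * c) / (a' + b + c + d)
        = (a - a') * (((b + d) * (c + d)) / ((a + b + c + d) * (a' + b + c + d))) := by
      field_simp
      ring
    rw [heq, abs_mul]
    refine mul_le_of_le_one_right (abs_nonneg _) ?_
    rw [abs_of_nonneg (by positivity), div_le_one (by positivity)]
    gcongr <;> linarith

theorem abs_normalized_det_sub_le_sum {a b c d a' b' c' d' : ℝ} (ha : 0 ≤ a) (hb : 0 ≤ b)
    (hc : 0 ≤ c) (hd : 0 ≤ d) (ha' : 0 ≤ a') (hb' : 0 ≤ b') (hc' : 0 ≤ c') (hd' : 0 ≤ d') :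
    |(a * d - b * c) / (a + b + c + d) - (a' * d' - b' * c') / (a' + b' + c' + d')|
      ≤ |a - a'| + |b - b'| + |c - c'| + |d - d'| := by
  have h₁ := abs_normalized_det_sub_le ha ha' hb hc hd
  have h₂ := abs_normalized_det_sub_le hb hb' ha' hd hc
  have h₃ := abs_normalized_det_sub_le hc hc' ha' hd hb'
  have h₄ := abs_normalized_det_sub_le hd hd' hb' hc' ha'
  have e₂ : (b * c - a' * d) / (b + a' + d + c) - (b' * c - a' * d) / (b' + a' + d + c)
      = (a' * d - b' * c) / (a' + b' + c + d) - (a' * d - b * c) / (a' + b + c + d) := by ring_nf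
  have e₃ : (c * b' - a' * d) / (c + a' + d + b') - (c' * b' - a' * d) / (c' + a' + d + b')
      = (a' * d - b' * c') / (a' + b' + c' + d) - (a' * d - b' * c) / (a' + b' + c + d) := by
    ring_nf
  have e₄ : (d * a' - b' * c') / (d + b' + c' + a') - (d' * a' - b' * c') / (d' + b' + c' + a')
      = (a' * d - b' * c') / (a' + b' + c' + d) - (a' * d' - b' * c') / (a' + b' + c' + d') := by
    ring_nf
  rw [e₂] at h₂
  rw [e₃] at h₃
  rw [e₄] at h₄
  rw [abs_le] at *
  constructor <;> linarith [h₁.1, h₁.2, h₂.1, h₂.2, h₃.1, h₃.2, h₄.1, h₄.2]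

/-- The weighted influence of a `2 × 2` table is twice its normalized absolute determinant. -/
theorem weighted_influence_eq {a b c d : ℝ} (ha : 0 ≤ a) (hb : 0 ≤ b) (hc : 0 ≤ c) (hd : 0 ≤ d) :
    (a + b + c + d) * (2 * ((a + c) / (a + b + c + d)) * ((b + d) / (a + b + c + d))
        * |a / (a + c) - b / (b + d)|)
      = 2 * |(a * d - b * c) / (a + b + c + d)| := by
  rcases eq_or_lt_of_le (show 0 ≤ a + c by positivity) with h | h
  · obtain rfl : a = 0 := by linarith
    obtain rfl : c = 0 := by linarith
    simp
  rcases eq_or_lt_of_le (show 0 ≤ b + d by positivity) with h' | h'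
  · obtain rfl : b = 0 := by linarith
    obtain rfl : d = 0 := by linarith
    simp
  have hs : 0 < a + b + c + d := by linarith
  have heq : a / (a + c) - b / (b + d) = (a * d - b * c) / ((a + c) * (b + d)) := by
    field_simp
    ring
  rw [heq, abs_div, abs_div, abs_of_pos hs, abs_of_pos (mul_pos h h')]
  field_simp

open Classical in
theorem prob_nonneg {p : ℕ} {μ : (Fin p → Bool) → ℝ} (hμ : ∀ x, 0 ≤ μ x)
    (A : (Fin p → Bool) → Prop) : 0 ≤ prob μ A :=
  Finset.sum_nonneg fun x _ => by split_ifs <;> simp [hμ]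

/-- The law of total probability for a coordinate. -/
theorem prob_eq_add {p : ℕ} (μ : (Fin p → Bool) → ℝ) (A : (Fin p → Bool) → Prop) (i : Fin p) :
    prob μ A = prob μ (fun x => x i = true ∧ A x) + prob μ (fun x => x i = false ∧ A x) := by
  simp only [prob]
  rw [← Finset.sum_add_distrib]
  refine Finset.sum_congr rfl fun x _ => ?_
  by_cases hA : A x <;> rcases Bool.eq_false_or_eq_true (x i) with hx | hx <;> simp [hx, hA]

/-- The mass of the cell `X_u = b, X_i = c, X_S = σ_S`. -/
def cellProb {p : ℕ} (μ : (Fin p → Bool) → ℝ) (u i : Fin p) (S : Finset (Fin p))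
    (σ : Fin p → Bool) (b c : Bool) : ℝ :=
  prob μ (fun x => x u = b ∧ x i = c ∧ agree S σ x)

theorem cellProb_nonneg {p : ℕ} {μ : (Fin p → Bool) → ℝ} (hμ : ∀ x, 0 ≤ μ x) (u i : Fin p)
    (S : Finset (Fin p)) (σ : Fin p → Bool) (b c : Bool) : 0 ≤ cellProb μ u i S σ b c :=
  prob_nonneg hμ _

theorem prob_mul_lamWeight_mul_condInf {p : ℕ} {μ : (Fin p → Bool) → ℝ} (hμ : ∀ x, 0 ≤ μ x)
    (u i : Fin p) (S : Finset (Fin p)) (σ : Fin p → Bool) :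
    prob μ (agree S σ) * (lamWeight μ i S σ * |condInf μ u i S σ|)
      = 2 * |(cellProb μ u i S σ true true * cellProb μ u i S σ false false
          - cellProb μ u i S σ true false * cellProb μ u i S σ false true)
        / (cellProb μ u i S σ true true + cellProb μ u i S σ true false
          + cellProb μ u i S σ false true + cellProb μ u i S σ false false)| := by
  have hmarg (c : Bool) : prob μ (fun x => x i = c ∧ agree S σ x)
      = cellProb μ u i S σ true c + cellProb μ u i S σ false c :=
    prob_eq_add μ _ u
  have htotal : prob μ (agree S σ) = cellProb μ u i S σ true true + cellProb μ u i S σ true false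
      + cellProb μ u i S σ false true + cellProb μ u i S σ false false := by
    rw [prob_eq_add μ _ i, hmarg, hmarg]
    ring
  rw [← weighted_influence_eq (cellProb_nonneg hμ ..) (cellProb_nonneg hμ ..)
    (cellProb_nonneg hμ ..) (cellProb_nonneg hμ ..), ← htotal]
  simp only [lamWeight, condInf, condProb, hmarg]
  rfl

/-- Extension by `false` of a configuration on `S`. -/
def extendConfig {p : ℕ} (S : Finset (Fin p)) (τ : S → Bool) (j : Fin p) : Bool :=
  if hj : j ∈ S then τ ⟨j, hj⟩ else false

theorem agree_extendConfig_iff {p : ℕ} (S : Finset (Fin p)) (τ : S → Bool) (x : Fin p → Bool) :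
    agree S (extendConfig S τ) x ↔ (fun j : S => x j) = τ := by
  simp only [agree, funext_iff, Subtype.forall]
  refine forall₂_congr fun j hj => ?_
  simp [extendConfig, hj]

theorem avgInf_eq_sum {p : ℕ} (μ : (Fin p → Bool) → ℝ) (u i : Fin p) (S : Finset (Fin p)) :
    avgInf μ u i S = ∑ τ : S → Bool, prob μ (agree S (extendConfig S τ))
      * (lamWeight μ i S (extendConfig S τ) * |condInf μ u i S (extendConfig S τ)|) := by
  classical
  have hcongr (x y : Fin p → Bool) (hxy : agree S y x) :
      lamWeight μ i S x * |condInf μ u i S x| = lamWeight μ i S y * |condInf μ u i S y| := by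
    have : agree S x = agree S y := by
      funext z
      exact propext (forall₂_congr fun j hj => by rw [hxy j hj])
    simp only [lamWeight, condInf, this]
  rw [avgInf, ← Finset.sum_fiberwise Finset.univ (fun (x : Fin p → Bool) (j : S) => x j)]
  refine Finset.sum_congr rfl fun τ _ => ?_
  rw [prob, Finset.sum_mul, Finset.sum_filter]
  refine Finset.sum_congr rfl fun x _ => ?_
  simp only [agree_extendConfig_iff]
  split_ifs with hx
  · rw [hcongr x _ ((agree_extendConfig_iff S τ x).mpr hx)]
  · simp

theorem abs_avgInf_sub_le {p : ℕ} {μ ν : (Fin p → Bool) → ℝ} (hμ : ∀ x, 0 ≤ μ x)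
    (hν : ∀ x, 0 ≤ ν x) (u i : Fin p) (S : Finset (Fin p)) {γ : ℝ}
    (hγ : ∀ σ b c, |cellProb μ u i S σ b c - cellProb ν u i S σ b c| ≤ γ) :
    |avgInf μ u i S - avgInf ν u i S| ≤ 2 ^ S.card * (8 * γ) := by
  rw [avgInf_eq_sum, avgInf_eq_sum, ← Finset.sum_sub_distrib]
  refine (Finset.abs_sum_le_sum_abs _ _).trans ?_
  refine (Finset.sum_le_card_nsmul _ _ (8 * γ) fun τ _ => ?_).trans_eq (by simp)
  rw [prob_mul_lamWeight_mul_condInf hμ, prob_mul_lamWeight_mul_condInf hν, ← mul_sub, abs_mul,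
    abs_two]
  set σ := extendConfig S τ
  have hμ' := cellProb_nonneg hμ u i S σ
  have hν' := cellProb_nonneg hν u i S σ
  have hdet := (abs_abs_sub_abs_le _ _).trans <|
    abs_normalized_det_sub_le_sum (hμ' true true) (hμ' true false) (hμ' false true)
      (hμ' false false) (hν' true true) (hν' true false) (hν' false true) (hν' false false)
  linarith [hγ σ true true, hγ σ true false, hγ σ false true, hγ σ false false]

/-- A cylinder event of codimension at most `ℓ + 2` is cut out by a list of `ℓ + 2` coordinate
constraints. -/
theorem exists_constraints {p ℓ : ℕ} (u i : Fin p) (S : Finset (Fin p)) (hS : S.card ≤ ℓ)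
    (σ : Fin p → Bool) (b c : Bool) :
    ∃ t : Fin (ℓ + 2) → Fin p × Bool, ∀ x : Fin p → Bool,
      (x u = b ∧ x i = c ∧ agree S σ x) ↔ ∀ k, x (t k).1 = (t k).2 := by
  let r : Fin ℓ → Fin p × Bool := fun k =>
    if hk : (k : ℕ) < S.card then ((S.equivFin.symm ⟨k, hk⟩ : Fin p), σ (S.equivFin.symm ⟨k, hk⟩))
    else (u, b)
  refine ⟨Fin.cons (u, b) (Fin.cons (i, c) r), fun x => ?_⟩
  simp only [Fin.forall_fin_succ, Fin.cons_zero, Fin.cons_succ]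
  refine and_congr_right fun hu => and_congr_right fun _ => ⟨fun hx k => ?_, fun hx j hj => ?_⟩
  · dsimp only [r]
    split_ifs with hk
    · exact hx _ (S.equivFin.symm ⟨k, hk⟩).2
    · exact hu
  · have hk := (S.equivFin ⟨j, hj⟩).2
    have := hx ⟨S.equivFin ⟨j, hj⟩, hk.trans_le hS⟩
    simpa [r] using this

theorem isingPMF_nonneg {p : ℕ} (G : SimpleGraph (Fin p)) [DecidableRel G.Adj]
    (θe : Fin p → Fin p → ℝ) (θv : Fin p → ℝ) (x : Fin p → Bool) : 0 ≤ isingPMF G θe θv x := by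
  unfold isingPMF
  positivity

theorem sum_isingPMF {p : ℕ} (G : SimpleGraph (Fin p)) [DecidableRel G.Adj]
    (θe : Fin p → Fin p → ℝ) (θv : Fin p → ℝ) : ∑ x, isingPMF G θe θv x = 1 := by
  simp only [isingPMF, ← Finset.sum_div]
  exact div_self (Finset.sum_pos (fun x _ => Real.exp_pos _) Finset.univ_nonempty).ne'

theorem deltaLB_pos (β h : ℝ) (d : ℕ) : 0 < deltaLB β h d := by
  unfold deltaLB
  positivity

theorem deltaLB_le_half {β h : ℝ} (hβ : 0 ≤ β) (hh : 0 ≤ h) (d : ℕ) : deltaLB β h d ≤ 1 / 2 := by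
  have : Real.exp (-(2 * (β * d + h))) ≤ 1 := Real.exp_le_one_iff.mpr (by
    have : 0 ≤ β * d := by positivity
    linarith)
  unfold deltaLB
  linarith

/-- The union bound over all lists of `ℓ + 2` coordinate constraints. -/
theorem union_bound_le {p ζ x : ℝ} (ℓ : ℕ) (hp : 2 ≤ p) (hζ : 0 < ζ) (hζ1 : ζ ≤ 1)
    (hx : 2 * (ℓ + 3) * Real.log (p / ζ) ≤ x) :
    (p * 2) ^ (ℓ + 2) * (2 * Real.exp (-x)) ≤ ζ := by
  have hp0 : 0 < p := by linarith
  have hexp : Real.exp (-x) ≤ (ζ / p) ^ (2 * (ℓ + 3)) := by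
    rw [← Real.exp_log (show 0 < ζ / p by positivity), ← Real.exp_nat_mul, Real.exp_le_exp,
      ← inv_div, Real.log_inv]
    push_cast
    linarith
  calc (p * 2) ^ (ℓ + 2) * (2 * Real.exp (-x))
      ≤ (p * 2) ^ (ℓ + 2) * (p * 2 * (ζ / p) ^ (2 * (ℓ + 3))) := by
        gcongr
        linarith
    _ = (p * 2) ^ (ℓ + 3) * (ζ / p) ^ (2 * (ℓ + 3)) := by ring
    _ ≤ (p * p) ^ (ℓ + 3) * (ζ / p) ^ (2 * (ℓ + 3)) := by gcongr
    _ = ζ ^ (2 * (ℓ + 3)) := by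
        rw [div_pow, ← sq, ← pow_mul]
        field_simp
    _ ≤ ζ := pow_le_of_le_one hζ.le hζ1 (by omega)

open Classical in
/-- accuracy of empirical influences. With probability at least `1 − ζ` over `n`
i.i.d. samples (the product measure on `n`-tuples of configurations), all empirical average
conditional influences with conditioning sets of size at most `ℓ` are within `ε` of the truth. -/
theorem stmt16
    {p d : ℕ} (G : SimpleGraph (Fin p)) [DecidableRel G.Adj]
    (θe : Fin p → Fin p → ℝ) (θv : Fin p → ℝ) (α β h : ℝ)
    (hα : 0 < α) (hαβ : α ≤ β) (hh : 0 ≤ h)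
    (hdeg : ∀ v, G.degree v ≤ d)
    (hsym : ∀ i j, θe i j = θe j i)
    (hedge : ∀ i j, G.Adj i j → α ≤ |θe i j| ∧ |θe i j| ≤ β)
    (hnonedge : ∀ i j, ¬ G.Adj i j → θe i j = 0)
    (hfield : ∀ i, |θv i| ≤ h)
    (n ℓ : ℕ) (ε ζ : ℝ) (hε : 0 < ε) (hζ : 0 < ζ)
    (hℓ : (ℓ : ℝ) ≤ p / 4 - 2)
    (hn : (n : ℝ) ≥ 144 * (ℓ + 3) / (ε ^ 2 * deltaLB β h d ^ (2 * ℓ)) * Real.log (p / ζ)) :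
    (1 : ℝ) - ζ ≤ ∑ xs : Fin n → (Fin p → Bool),
      (if (∀ (u i : Fin p) (S : Finset (Fin p)), u ≠ i → u ∉ S → i ∉ S → S.card ≤ ℓ →
            |avgInf (isingPMF G θe θv) u i S
              - avgInf (fun x => ((Finset.univ.filter (fun t => xs t = x)).card : ℝ) / n) u i S|
              ≤ ε)
        then ∏ t, isingPMF G θe θv (xs t) else 0) := by
  have hw := isingPMF_nonneg G θe θv
  have hw1 := sum_isingPMF G θe θv
  set w := isingPMF G θe θv
  have hprod (xs : Fin n → (Fin p → Bool)) : 0 ≤ ∏ t, w (xs t) :=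
    Finset.prod_nonneg fun t _ => hw _
  rcases lt_or_ge 1 ζ with hζ1 | hζ1
  · refine le_trans (by linarith) (Finset.sum_nonneg fun xs _ => ?_)
    split_ifs
    exacts [hprod xs, le_rfl]
  have hp : (2 : ℝ) ≤ p := by linarith [(Nat.cast_nonneg ℓ : (0 : ℝ) ≤ ℓ)]
  have hδ := deltaLB_pos β h d
  have hδ2 := deltaLB_le_half (hα.le.trans hαβ) hh d
  set δ := deltaLB β h d
  have hlog : 0 < Real.log (p / ζ) := Real.log_pos (by rw [lt_div_iff₀ hζ]; linarith)
  have hn0 : 0 < n := by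
    have : (0 : ℝ) < n := lt_of_lt_of_le (by positivity) hn
    exact_mod_cast this
  set γ := ε * δ ^ ℓ / 8 with hγ
  have hγ0 : 0 ≤ γ := by positivity
  let event (t : Fin (ℓ + 2) → Fin p × Bool) (x : Fin p → Bool) : Prop :=
    ∀ k, x (t k).1 = (t k).2
  have hgood (xs : Fin n → (Fin p → Bool))
      (hxs : ∀ t, |prob w (event t) - prob (empirical xs) (event t)| ≤ γ)
      (u i : Fin p) (S : Finset (Fin p)) (hS : S.card ≤ ℓ) :
      |avgInf w u i S - avgInf (empirical xs) u i S| ≤ ε := by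
    refine (abs_avgInf_sub_le hw (empirical_nonneg xs) u i S (γ := γ) fun σ b c => ?_).trans ?_
    · obtain ⟨t, ht⟩ := exists_constraints u i S hS σ b c
      have heq : (fun x : Fin p → Bool => x u = b ∧ x i = c ∧ agree S σ x) = event t :=
        funext fun x => propext (ht x)
      rw [cellProb, cellProb, heq]
      exact hxs t
    · calc (2 : ℝ) ^ S.card * (8 * γ) ≤ 2 ^ ℓ * (8 * γ) := by gcongr; norm_num
        _ = ε * (2 * δ) ^ ℓ := by rw [hγ, mul_pow]; ring
        _ ≤ ε := mul_le_of_le_one_right hε.le (pow_le_one₀ (by positivity) (by linarith))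
  have hbad : ∑ t, ∑ xs : Fin n → (Fin p → Bool),
      (if γ < |prob w (event t) - prob (empirical xs) (event t)| then ∏ t, w (xs t) else 0)
      ≤ ζ := by
    refine (Finset.sum_le_card_nsmul _ _ _ fun t _ =>
      prob_empirical_deviation_le w hw hw1 (event t) n hn0 γ hγ0).trans ?_
    simp only [Finset.card_univ, Fintype.card_fun, Fintype.card_prod, Fintype.card_fin,
      Fintype.card_bool, nsmul_eq_mul, Nat.cast_pow, Nat.cast_mul, Nat.cast_ofNat]
    refine union_bound_le ℓ hp hζ hζ1 ?_
    have hmul := mul_le_mul_of_nonneg_right hn (show 0 ≤ ε ^ 2 * δ ^ (2 * ℓ) / 32 by positivity)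
    have hcancel : 144 * (ℓ + 3) / (ε ^ 2 * δ ^ (2 * ℓ)) * Real.log (p / ζ)
        * (ε ^ 2 * δ ^ (2 * ℓ) / 32) = 9 / 2 * ((ℓ + 3) * Real.log (p / ζ)) := by
      field_simp
      norm_num
    have hsq : 2 * n * γ ^ 2 = n * (ε ^ 2 * δ ^ (2 * ℓ) / 32) := by rw [hγ]; ring
    have : 0 ≤ (ℓ + 3) * Real.log (p / ζ) := by positivity
    rw [hsq]
    linarith
  have htotal : ∑ xs : Fin n → (Fin p → Bool), ∏ t, w (xs t) = 1 := by
    rw [← Fintype.sum_pow, hw1, one_pow]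
  rw [Finset.sum_comm] at hbad
  rw [sub_le_iff_le_add, ← htotal]
  refine le_trans ?_ (add_le_add le_rfl hbad)
  rw [← Finset.sum_add_distrib]
  refine Finset.sum_le_sum fun xs _ => ?_
  have hnonneg (t : Fin (ℓ + 2) → Fin p × Bool) : 0 ≤
      if γ < |prob w (event t) - prob (empirical xs) (event t)| then ∏ t, w (xs t) else 0 := by
    split_ifs
    exacts [hprod xs, le_rfl]
  by_cases hxs : ∀ t, |prob w (event t) - prob (empirical xs) (event t)| ≤ γ
  · rw [if_pos fun u i S _ _ _ hS => ?_]
    · exact le_add_of_nonneg_right (Finset.sum_nonneg fun t _ => hnonneg t)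
    · convert hgood xs hxs u i S hS
      rw [empirical]
  · push Not at hxs
    obtain ⟨t, ht⟩ := hxs
    have hsingle := Finset.single_le_sum (fun t _ => hnonneg t) (Finset.mem_univ t)
    rw [if_pos ht] at hsingle
    refine hsingle.trans (le_add_of_nonneg_left ?_)
    split_ifs
    exacts [hprod xs, le_rfl]
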